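/- arXiv:1608.02269 — 2 statements merged into one kernel-verified Lean document; each statement's English description precedes it below -/
import Mathlib

section
/- There exists a decomposition 𝒞_n = Σ_{j=1}^n 𝒞_n^{(j)} into operators 𝒞_n^{(j)} on (ℂ²)^⊗n such that the following algebraic relations hold for all j, k: (i) 𝒞_n^{(j)} 𝒜_n = ((e u_j+f)/(a u_j+b)) · 𝒜_n 𝒞_n^{(j)}; (ii) (𝒞_n^{(j)})² = 0; (iii) for j ≠ k, 𝒞_n^{(j)} 𝒞_n^{(k)} = [(e u_j+f)(a u_k+b)(u_j − t u_k)] / [(a u_j+b)(e u_k+f)(t u_j − u_k)] · 𝒞_n^{(k)} 𝒞_n^{(j)}. -/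
open Finset

variable {K : Type*} [Field K]

/-- Matrix elements `⟨γ, δ| L(u) |α, β⟩` of the homogeneous `L`-operator:
`γ` auxiliary output, `δ` quantum output, `α` auxiliary input, `β` quantum input. -/
def LL (t a b c d e f u : K) (γ δ α β : Fin 2) : K :=
  if γ = 0 ∧ δ = 0 ∧ α = 0 ∧ β = 0 then a * u + b
  else if γ = 0 ∧ δ = 1 ∧ α = 0 ∧ β = 1 then a * t * u + b
  else if γ = 0 ∧ δ = 1 ∧ α = 1 ∧ β = 0 then (1 - t) * c * u
  else if γ = 1 ∧ δ = 0 ∧ α = 0 ∧ β = 1 then (1 - t) * d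
  else if γ = 1 ∧ δ = 0 ∧ α = 1 ∧ β = 0 then e * u + f
  else if γ = 1 ∧ δ = 1 ∧ α = 1 ∧ β = 1 then e * u + t * f
  else 0

/-- The operator `𝒜_n = ⟨0|_{V_j} L_{nj}(u_n) ⋯ L_{1j}(u₁) |0⟩_{V_j}`
on `W₁ ⊗ ⋯ ⊗ W_n = (ℂ²)^{⊗n}`. -/
def colA (n : ℕ) (t a b c d e f : K) (u : Fin n → K) :
    Matrix (Fin n → Fin 2) (Fin n → Fin 2) K :=
  Matrix.of fun γ β =>
    ∑ δ : Fin (n + 1) → Fin 2,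
      if δ 0 = 0 ∧ δ (Fin.last n) = 0 then
        ∏ i : Fin n, LL t a b c d e f (u i) (γ i) (δ i.succ) (β i) (δ i.castSucc)
      else 0

/-- The operator `𝒞_n = ⟨1|_{V_j} L_{nj}(u_n) ⋯ L_{1j}(u₁) |0⟩_{V_j}`
on `W₁ ⊗ ⋯ ⊗ W_n = (ℂ²)^{⊗n}`. -/
def colC (n : ℕ) (t a b c d e f : K) (u : Fin n → K) :
    Matrix (Fin n → Fin 2) (Fin n → Fin 2) K :=
  Matrix.of fun γ β =>
    ∑ δ : Fin (n + 1) → Fin 2,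
      if δ 0 = 0 ∧ δ (Fin.last n) = 1 then
        ∏ i : Fin n, LL t a b c d e f (u i) (γ i) (δ i.succ) (β i) (δ i.castSucc)
      else 0

/-- The relations of the theorem, in an abstract algebra, together with invertibility of `A`. -/
def GoodRel {R : Type*} [Ring R] [Algebra K R] (n : ℕ) (t a b e f : K) (u : Fin n → K)
    (A C : R) : Prop :=
  ∃ (B : R) (Cj : Fin n → R), A * B = 1 ∧ B * A = 1 ∧ (∑ j, Cj j) = C ∧
      (∀ j, Cj j * A = ((e * u j + f) / (a * u j + b)) • (A * Cj j)) ∧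
      (∀ j, Cj j * Cj j = 0) ∧
      (∀ j k, j ≠ k → Cj j * Cj k =
          ((e * u j + f) * (a * u k + b) * (u j - t * u k) /
            ((a * u j + b) * (e * u k + f) * (t * u j - u k))) • (Cj k * Cj j))

theorem GoodRel.map {R S : Type*} [Ring R] [Algebra K R] [Ring S] [Algebra K S] {n : ℕ}
    {t a b e f : K} {u : Fin n → K} {A C : R} (h : GoodRel n t a b e f u A C)
    (φ : R →ₐ[K] S) : GoodRel n t a b e f u (φ A) (φ C) := by
  obtain ⟨B, Cj, h1, h2, h3, h4, h5, h6⟩ := h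
  refine ⟨φ B, fun j => φ (Cj j), ?_, ?_, ?_, ?_, ?_, ?_⟩
  · rw [← map_mul, h1, map_one]
  · rw [← map_mul, h2, map_one]
  · rw [← map_sum, h3]
  · intro j
    rw [← map_mul, h4, map_smul, map_mul]
  · intro j
    rw [← map_mul, h5, map_zero]
  · intro j k hjk
    rw [← map_mul, h6 j k hjk, map_smul, map_mul]

/-- Conjugation by an invertible element. -/
def conjHom {R : Type*} [Ring R] [Algebra K R] (G H : R) (hGH : G * H = 1) (hHG : H * G = 1) :
    R →ₐ[K] R :=
  AlgHom.ofLinearMap ((LinearMap.mulLeft K G).comp (LinearMap.mulRight K H))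
    (by simp [hGH])
    (by
      intro x y
      simp only [LinearMap.comp_apply, LinearMap.mulLeft_apply, LinearMap.mulRight_apply]
      calc G * (x * y * H) = G * x * 1 * y * H := by noncomm_ring
        _ = G * x * (H * G) * y * H := by rw [hHG]
        _ = _ := by noncomm_ring)

theorem conjHom_apply {R : Type*} [Ring R] [Algebra K R] (G H : R) (hGH : G * H = 1)
    (hHG : H * G = 1) (x : R) : conjHom (K := K) G H hGH hHG x = G * x * H := by
  simp [conjHom, AlgHom.ofLinearMap, mul_assoc]

theorem goodRel_diag {I : Type*} [Fintype I] [DecidableEq I] {n : ℕ}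
    (t a b e f : K) (u : Fin n → K) (w : K)
    (p q s : K) (x : Fin n → K) (A B : Matrix I I K) (Cj : Fin n → Matrix I I K)
    (hab : a * w + b ≠ 0) (hef : e * w + f ≠ 0)
    (habu : ∀ j, a * u j + b ≠ 0) (hefu : ∀ j, e * u j + f ≠ 0)
    (hw : ∀ j, u j ≠ w)
    (ht1 : ∀ j, t * u j ≠ w) (ht2 : ∀ j, t * w ≠ u j)
    (h1 : A * B = 1) (h2 : B * A = 1)
    (h4 : ∀ j, Cj j * A = ((e * u j + f) / (a * u j + b)) • (A * Cj j))
    (h5 : ∀ j, Cj j * Cj j = 0)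
    (h6 : ∀ j k, j ≠ k → Cj j * Cj k =
          ((e * u j + f) * (a * u k + b) * (u j - t * u k) /
            ((a * u j + b) * (e * u k + f) * (t * u j - u k))) • (Cj k * Cj j))
    (hp : ∀ j, p + q * x j = (u j - t * w) * (a * w + b) / (u j - w))
    (hs : ∀ j, s - q * x j * ((e * u j + f) / (a * u j + b)) =
      (t * u j - w) * (e * w + f) / (u j - w)) :
    GoodRel (R := Matrix (I ⊕ I) (I ⊕ I) K) (n + 1) t a b e f (Fin.snoc u w : Fin (n + 1) → K)
      (Matrix.fromBlocks ((a * w + b) • A) 0 0 ((e * w + f) • A))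
      (Matrix.fromBlocks (∑ j, (p + q * x j) • Cj j) (q • A) 0
        (∑ j, (s - q * x j * ((e * u j + f) / (a * u j + b))) • Cj j)) := by
  refine ⟨Matrix.fromBlocks ((a * w + b)⁻¹ • B) 0 0 ((e * w + f)⁻¹ • B),
    Fin.snoc (fun j => Matrix.fromBlocks ((p + q * x j) • Cj j) 0 0
      ((s - q * x j * ((e * u j + f) / (a * u j + b))) • Cj j))
      (Matrix.fromBlocks 0 (q • A) 0 0), ?_, ?_, ?_, ?_, ?_, ?_⟩
  · simp [Matrix.fromBlocks_multiply, h1, smul_smul, hab, hef]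
  · simp [Matrix.fromBlocks_multiply, h2, smul_smul, hab, hef]
  · rw [Fin.sum_univ_castSucc]
    simp only [Fin.snoc_castSucc, Fin.snoc_last]
    have : ∀ (S : Finset (Fin n)) (X Y : Fin n → Matrix I I K),
        ∑ j ∈ S, Matrix.fromBlocks (X j) 0 0 (Y j)
          = Matrix.fromBlocks (∑ j ∈ S, X j) 0 0 (∑ j ∈ S, Y j) := by
      intro S X Y
      induction S using Finset.induction_on with
      | empty => simp
      | insert i S hi ih =>
        rw [Finset.sum_insert hi, Finset.sum_insert hi, Finset.sum_insert hi, ih,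
          Matrix.fromBlocks_add]
        simp
    rw [this, Matrix.fromBlocks_add]
    simp
  · intro j
    refine Fin.lastCases ?_ (fun j => ?_) j
    · simp only [Fin.snoc_last, Matrix.fromBlocks_multiply, Matrix.fromBlocks_smul]
      simp only [smul_mul_smul_comm, smul_smul, mul_zero, zero_mul, add_zero, zero_add, smul_zero]
      congr 2
      rw [mul_comm (a * w + b) q, ← mul_assoc, mul_comm _ q, mul_assoc, div_mul_cancel₀ _ hab]
    · simp only [Fin.snoc_castSucc, Matrix.fromBlocks_multiply, Matrix.fromBlocks_smul]
      simp only [smul_mul_smul_comm, smul_smul, mul_zero, zero_mul, add_zero, zero_add, smul_zero,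
        h4]
      congr 2 <;> ring
  · intro j
    refine Fin.lastCases ?_ (fun j => ?_) j
    · simp [Matrix.fromBlocks_multiply]
    · simp [Matrix.fromBlocks_multiply, h5]
  · have hlast : ∀ j, (p + q * x j) * q * ((e * u j + f) / (a * u j + b)) =
        ((e * u j + f) * (a * w + b) * (u j - t * w) /
          ((a * u j + b) * (e * w + f) * (t * u j - w))) *
        (q * (s - q * x j * ((e * u j + f) / (a * u j + b)))) := by
      intro j
      rw [hp, hs]
      have := sub_ne_zero.mpr (hw j)
      have := sub_ne_zero.mpr (ht1 j)
      have := habu j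
      generalize a * w + b = y1 at *
      generalize e * w + f = y2 at *
      generalize a * u j + b = y3 at *
      generalize t * u j - w = y4 at *
      field_simp
    intro j k
    refine Fin.lastCases ?_ (fun j => ?_) j
    · refine Fin.lastCases ?_ (fun k => ?_) k
      · intro h
        exact absurd rfl h
      · intro _
        simp only [Fin.snoc_castSucc, Fin.snoc_last, Matrix.fromBlocks_multiply,
          Matrix.fromBlocks_smul]
        simp only [smul_mul_smul_comm, smul_smul, mul_zero, zero_mul, add_zero, zero_add,
          smul_zero, h4]
        congr 2
        rw [hlast k]
        have := sub_ne_zero.mpr (hw k)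
        have := sub_ne_zero.mpr (ht1 k)
        have := sub_ne_zero.mpr (ht2 k)
        have := habu k
        have := hefu k
        have h7 : (e * w + f) * (a * u k + b) * (w - t * u k) /
          ((a * w + b) * (e * u k + f) * (t * w - u k)) *
          ((e * u k + f) * (a * w + b) * (u k - t * w) /
          ((a * u k + b) * (e * w + f) * (t * u k - w))) = 1 := by
          rw [div_mul_div_comm, div_eq_one_iff_eq (by simp [*])]
          ring
        rw [← mul_assoc, h7, one_mul]
    · refine Fin.lastCases ?_ (fun k => ?_) k
      · intro _
        simp only [Fin.snoc_castSucc, Fin.snoc_last, Matrix.fromBlocks_multiply,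
          Matrix.fromBlocks_smul]
        simp only [smul_mul_smul_comm, smul_smul, mul_zero, zero_mul, add_zero, zero_add,
          smul_zero, h4]
        congr 2
        exact hlast j
      · intro hjk
        have hjk' : j ≠ k := fun h => hjk (by rw [h])
        simp only [Fin.snoc_castSucc, Matrix.fromBlocks_multiply, Matrix.fromBlocks_smul]
        simp only [smul_mul_smul_comm, smul_smul, mul_zero, zero_mul, add_zero, zero_add,
          smul_zero, h6 j k hjk']
        congr 2 <;> ring

theorem goodRel_step {I : Type*} [Fintype I] [DecidableEq I] {n : ℕ}
    (t a b c d e f : K)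
    (ht : t ≠ 1) (ha : a ≠ 0) (hb : b ≠ 0) (hc : c ≠ 0) (hd : d ≠ 0)
    (he : e ≠ 0) (hf : f ≠ 0)
    (hcon1 : c * d + a * f = 0) (hcon2 : t * (c * d) + b * e = 0) (u : Fin n → K) (w : K)
    (A C : Matrix I I K)
    (hab : a * w + b ≠ 0) (hef : e * w + f ≠ 0)
    (habu : ∀ j, a * u j + b ≠ 0) (hefu : ∀ j, e * u j + f ≠ 0)
    (hw : ∀ j, u j ≠ w)
    (ht1 : ∀ j, t * u j ≠ w) (ht2 : ∀ j, t * w ≠ u j)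
    (htu : ∀ j k, j ≠ k → t * u j ≠ u k)
    (h : GoodRel n t a b e f u A C) :
    GoodRel (R := Matrix (I ⊕ I) (I ⊕ I) K) (n + 1) t a b e f (Fin.snoc u w : Fin (n + 1) → K)
      (Matrix.fromBlocks ((a * w + b) • A) 0 (((1 - t) * d) • C) ((e * w + f) • A))
      (Matrix.fromBlocks ((a * t * w + b) • C) (((1 - t) * c * w) • A) 0
        ((e * w + t * f) • C)) := by
  obtain ⟨B, Cj, h1, h2, h3, h4, h5, h6⟩ := h
  have hd' : d = - (a * f) / c := by
    field_simp
    linear_combination hcon1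
  have he' : e = t * a * f / b := by
    field_simp
    linear_combination hcon2 - t * hcon1
  set x : Fin n → K := fun j => - d * (a * u j + b) / (a * f * (u j - w)) with hx
  set X : Matrix I I K := ∑ j, x j • (B * Cj j) with hX
  have hA : ∀ M : Matrix I I K, A * (B * M) = M := fun M => by rw [← mul_assoc, h1, one_mul]
  have hB : ∀ M : Matrix I I K, B * (A * M) = M := fun M => by rw [← mul_assoc, h2, one_mul]
  have hCB : ∀ j, Cj j * B = ((a * u j + b) / (e * u j + f)) • (B * Cj j) := by
    intro j
    have h7 : B * (Cj j * A) * B = B * Cj j := by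
      rw [mul_assoc, mul_assoc, h1, mul_one]
    rw [h4, mul_smul_comm, hB, smul_mul_assoc] at h7
    have := habu j
    have := hefu j
    rw [← h7, smul_smul, div_mul_div_comm, mul_comm (a * u j + b), div_self (mul_ne_zero (hefu j) (habu j)),
      one_smul]
  have hAX : A * X = ∑ j, x j • Cj j := by
    rw [hX, Finset.mul_sum]
    simp only [mul_smul_comm, hA]
  have hXA : X * A = ∑ j, (x j * ((e * u j + f) / (a * u j + b))) • Cj j := by
    rw [hX, Finset.sum_mul]
    simp only [smul_mul_assoc, mul_assoc, h4, mul_smul_comm, hB, smul_smul]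
  have hcomm : ((1 - t) * d) • C + (e * w + f) • (A * X) = (a * w + b) • (X * A) := by
    rw [hAX, hXA, ← h3, Finset.smul_sum, Finset.smul_sum, Finset.smul_sum,
      ← Finset.sum_add_distrib]
    refine Finset.sum_congr rfl fun j _ => ?_
    rw [smul_smul, smul_smul, ← add_smul]
    congr 1
    have := sub_ne_zero.mpr (hw j)
    have := habu j
    simp only [hx]
    rw [he']
    field_simp
    ring
  have hp : ∀ j, (a * t * w + b) + ((1 - t) * c * w) * x j
      = (u j - t * w) * (a * w + b) / (u j - w) := by
    intro j
    have := sub_ne_zero.mpr (hw j)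
    simp only [hx]
    rw [hd']
    field_simp
    ring
  have hs : ∀ j, (e * w + t * f) - ((1 - t) * c * w) * x j * ((e * u j + f) / (a * u j + b)) =
      (t * u j - w) * (e * w + f) / (u j - w) := by
    intro j
    have := sub_ne_zero.mpr (hw j)
    have := habu j
    simp only [hx]
    rw [hd']
    field_simp
    ring
  have key : (e * w + t * f) • (C * X) - (a * t * w + b) • (X * C)
      - ((1 - t) * c * w) • (X * (A * X)) = 0 := by
    have e1 : C * X = ∑ j, ∑ k, (x k * ((a * u j + b) / (e * u j + f))) • (B * (Cj j * Cj k)) := by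
      rw [hX, ← h3, Finset.sum_mul]
      refine Finset.sum_congr rfl fun j _ => ?_
      rw [Finset.mul_sum]
      refine Finset.sum_congr rfl fun k _ => ?_
      rw [mul_smul_comm, ← mul_assoc, hCB, smul_mul_assoc, smul_smul, mul_assoc]
    have e2 : X * C = ∑ j, ∑ k, (x j) • (B * (Cj j * Cj k)) := by
      rw [hX, ← h3, Finset.sum_mul]
      refine Finset.sum_congr rfl fun j _ => ?_
      rw [Finset.mul_sum]
      refine Finset.sum_congr rfl fun k _ => ?_
      rw [smul_mul_assoc, mul_assoc]
    have e3 : X * (A * X) = ∑ j, ∑ k, (x j * x k) • (B * (Cj j * Cj k)) := by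
      rw [hAX, hX, Finset.sum_mul]
      refine Finset.sum_congr rfl fun j _ => ?_
      rw [Finset.mul_sum]
      refine Finset.sum_congr rfl fun k _ => ?_
      rw [smul_mul_smul_comm, mul_assoc]
    rw [e1, e2, e3]
    simp only [Finset.smul_sum, smul_smul, ← Finset.sum_sub_distrib, ← sub_smul]
    rw [← Finset.sum_product']
    refine Finset.sum_involution (fun z _ => (z.2, z.1)) ?_ ?_ (by simp) (by simp)
    · rintro ⟨j, k⟩ _
      by_cases hjk : j = k
      · subst hjk
        simp [h5]
      · simp only
        rw [h6 j k hjk, mul_smul_comm, smul_smul, ← add_smul]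
        convert zero_smul K _
        have n1 := sub_ne_zero.mpr (hw j)
        have n2 := sub_ne_zero.mpr (hw k)
        have n3 := sub_ne_zero.mpr (htu j k hjk)
        have n4 := habu j
        have n5 := habu k
        have n6 : t * a * u j + b ≠ 0 := by
          have := hefu j
          rw [he'] at this
          intro h0
          apply this
          rw [div_mul_eq_mul_div, div_add' _ _ _ hb, div_eq_zero_iff]
          left
          linear_combination f * h0
        have n7 : t * a * u k + b ≠ 0 := by
          have := hefu k
          rw [he'] at this
          intro h0
          apply this
          rw [div_mul_eq_mul_div, div_add' _ _ _ hb, div_eq_zero_iff]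
          left
          linear_combination f * h0
        have z1 : ∀ y, e * y + f = f * (t * a * y + b) / b := by
          intro y
          rw [he']
          field_simp
        have z2 : e * w + t * f = t * f * (a * w + b) / b := by
          rw [he']
          field_simp
        simp only [hx]
        rw [z2, z1, z1, hd']
        field_simp
        ring
    · rintro ⟨j, k⟩ _ hne heq
      simp only [Prod.mk.injEq] at heq
      apply hne
      simp only
      rw [heq.1, h5]
      simp
  have hG := (goodRel_diag t a b e f u w (a * t * w + b) ((1 - t) * c * w) (e * w + t * f) x A B
    Cj hab hef habu hefu hw ht1 ht2 h1 h2 h4 h5 h6 hp hs)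
  have hg1 : (Matrix.fromBlocks 1 0 X 1 : Matrix (I ⊕ I) (I ⊕ I) K) *
      Matrix.fromBlocks 1 0 (-X) 1 = 1 := by
    simp [Matrix.fromBlocks_multiply]
  have hg2 : (Matrix.fromBlocks 1 0 (-X) 1 : Matrix (I ⊕ I) (I ⊕ I) K) *
      Matrix.fromBlocks 1 0 X 1 = 1 := by
    simp [Matrix.fromBlocks_multiply]
  have hG2 := hG.map (conjHom (K := K) _ _ hg1 hg2)
  rw [conjHom_apply, conjHom_apply] at hG2
  have q1 : ∑ j, (a * t * w + b + (1 - t) * c * w * x j) • Cj j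
      = (a * t * w + b) • C + ((1 - t) * c * w) • (A * X) := by
    rw [hAX, ← h3, Finset.smul_sum, Finset.smul_sum, ← Finset.sum_add_distrib]
    simp only [smul_smul, add_smul]
  have q2 : ∑ j, ((e * w + t * f) - ((1 - t) * c * w) * x j *
        ((e * u j + f) / (a * u j + b))) • Cj j
      = (e * w + t * f) • C - ((1 - t) * c * w) • (X * A) := by
    rw [hXA, ← h3, Finset.smul_sum, Finset.smul_sum, ← Finset.sum_sub_distrib]
    simp only [smul_smul, sub_smul, mul_assoc]
  rw [q1, q2] at hG2
  convert hG2 using 1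
  · rw [Matrix.fromBlocks_multiply, Matrix.fromBlocks_multiply]
    congr 1
    · simp
    · simp
    · simp only [mul_zero, zero_mul, one_mul, mul_one, add_zero, zero_add, mul_neg,
        mul_smul_comm, smul_mul_assoc]
      rw [← hcomm]
      abel
    · simp
  · rw [Matrix.fromBlocks_multiply, Matrix.fromBlocks_multiply]
    congr 1
    · simp
    · simp
    · simp only [mul_zero, zero_mul, one_mul, mul_one, add_zero, zero_add, mul_neg,
        mul_smul_comm, smul_mul_assoc, Matrix.mul_add, Matrix.sub_mul, Matrix.mul_assoc]
      rw [← smul_mul_assoc (e * w + t * f) C X] at key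
      rw [← neg_zero, ← key]
      abel
    · simp

/-- Common generalization of `colA` and `colC`. -/
def colT (n : ℕ) (t a b c d e f : K) (u : Fin n → K) (x : Fin 2) :
    Matrix (Fin n → Fin 2) (Fin n → Fin 2) K :=
  Matrix.of fun γ β =>
    ∑ δ : Fin (n + 1) → Fin 2,
      if δ 0 = 0 ∧ δ (Fin.last n) = x then
        ∏ i : Fin n, LL t a b c d e f (u i) (γ i) (δ i.succ) (β i) (δ i.castSucc)
      else 0

theorem colT_succ (n : ℕ) (t a b c d e f : K) (u : Fin n → K) (w : K) (x : Fin 2)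
    (γ β : Fin n → Fin 2) (g h : Fin 2) :
    colT (n + 1) t a b c d e f (Fin.snoc u w : Fin (n + 1) → K) x
      (Fin.snoc γ g : Fin (n + 1) → Fin 2) (Fin.snoc β h : Fin (n + 1) → Fin 2)
      = ∑ y : Fin 2, LL t a b c d e f w g x h y * colT n t a b c d e f u y γ β := by
  simp only [colT, Matrix.of_apply, Finset.mul_sum]
  rw [Finset.sum_comm]
  rw [← (Fin.snocEquiv (fun _ : Fin (n + 2) => Fin 2)).sum_comp, Fintype.sum_prod_type_right]
  refine Finset.sum_congr rfl fun δ _ => ?_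
  rw [Finset.sum_eq_single x, Finset.sum_eq_single (δ (Fin.last n))]
  · have h0 : (Fin.snoc δ x : Fin (n + 2) → Fin 2) 0 = δ 0 := by
      rw [← Fin.castSucc_zero, Fin.snoc_castSucc]
    have hs : ∀ i : Fin n, (Fin.snoc δ x : Fin (n + 2) → Fin 2) i.castSucc.succ = δ i.succ := by
      intro i
      rw [Fin.succ_castSucc, Fin.snoc_castSucc]
    simp only [Fin.snocEquiv, Equiv.coe_fn_mk, Fin.prod_univ_castSucc, Fin.snoc_castSucc,
      Fin.snoc_last, Fin.succ_last, h0, hs, and_true]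
    split_ifs
    · ring
    · simp
  · intro y _ hy
    rw [if_neg (fun h => hy h.2.symm), mul_zero]
  · simp
  · intro y _ hy
    rw [if_neg]
    simp [Fin.snocEquiv, hy]
  · simp

/-- Splitting off the last tensor factor. -/
def lastEquiv (n : ℕ) : (Fin n → Fin 2) ⊕ (Fin n → Fin 2) ≃ (Fin (n + 1) → Fin 2) where
  toFun := Sum.elim (fun γ => Fin.snoc γ 0) (fun γ => Fin.snoc γ 1)
  invFun γ := if γ (Fin.last n) = 0 then Sum.inl (Fin.init γ) else Sum.inr (Fin.init γ)
  left_inv := by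
    rintro (γ | γ) <;> simp
  right_inv := by
    intro γ
    by_cases h : γ (Fin.last n) = 0
    · simp only [h, if_true, Sum.elim_inl]
      rw [← h, Fin.snoc_init_self]
    · simp only [h, if_false, Sum.elim_inr]
      have h' : γ (Fin.last n) = 1 := by omega
      rw [← h', Fin.snoc_init_self]

theorem colT_zero_succ (n : ℕ) (t a b c d e f : K) (u : Fin n → K) (w : K) :
    colT (n + 1) t a b c d e f (Fin.snoc u w : Fin (n + 1) → K) 0 =
      Matrix.reindexAlgEquiv K K (lastEquiv n)
        (Matrix.fromBlocks ((a * w + b) • colT n t a b c d e f u 0) 0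
          (((1 - t) * d) • colT n t a b c d e f u 1) ((e * w + f) • colT n t a b c d e f u 0)) := by
  rw [← AlgEquiv.symm_apply_eq]
  ext i j
  rcases i with i | i <;> rcases j with j | j <;>
    simp [lastEquiv, colT_succ, LL, Fin.sum_univ_two]

theorem colT_one_succ (n : ℕ) (t a b c d e f : K) (u : Fin n → K) (w : K) :
    colT (n + 1) t a b c d e f (Fin.snoc u w : Fin (n + 1) → K) 1 =
      Matrix.reindexAlgEquiv K K (lastEquiv n)
        (Matrix.fromBlocks ((a * t * w + b) • colT n t a b c d e f u 1)
          (((1 - t) * c * w) • colT n t a b c d e f u 0) 0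
          ((e * w + t * f) • colT n t a b c d e f u 1)) := by
  rw [← AlgEquiv.symm_apply_eq]
  ext i j
  rcases i with i | i <;> rcases j with j | j <;>
    simp [lastEquiv, colT_succ, LL, Fin.sum_univ_two]

theorem goodRel_colT (n : ℕ) (t a b c d e f : K)
    (ht : t ≠ 1) (ha : a ≠ 0) (hb : b ≠ 0) (hc : c ≠ 0) (hd : d ≠ 0)
    (he : e ≠ 0) (hf : f ≠ 0)
    (hcon1 : c * d + a * f = 0) (hcon2 : t * (c * d) + b * e = 0)
    (u : Fin n → K)
    (hab : ∀ j, a * u j + b ≠ 0) (hef : ∀ j, e * u j + f ≠ 0)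
    (hdist : ∀ j k, j ≠ k → u j ≠ u k)
    (htdist : ∀ j k, j ≠ k → t * u j ≠ u k) :
    GoodRel n t a b e f u (colT n t a b c d e f u 0) (colT n t a b c d e f u 1) := by
  induction n with
  | zero =>
    have h0 : colT 0 t a b c d e f u 0 = 1 := by
      ext i j
      rw [Subsingleton.elim i j, Matrix.one_apply_eq]
      simp only [colT, Matrix.of_apply, Finset.univ_eq_empty, Finset.prod_empty]
      rw [Finset.sum_eq_single (fun _ => 0)]
      · simp
      · intro δ _ hδ
        rw [if_neg]
        intro h
        apply hδ
        funext i
        rw [show i = 0 from Fin.ext (by have := i.isLt; simp), h.1]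
      · simp
    have h1 : colT 0 t a b c d e f u 1 = 0 := by
      ext i j
      simp only [colT, Matrix.of_apply, Matrix.zero_apply]
      refine Finset.sum_eq_zero fun δ _ => ?_
      rw [if_neg]
      rintro ⟨h2, h3⟩
      rw [show Fin.last 0 = 0 from rfl, h2] at h3
      exact absurd h3 (by decide)
    rw [h0, h1]
    exact ⟨1, fun _ => 0, by simp, by simp, by simp, fun j => j.elim0, fun j => j.elim0,
      fun j => j.elim0⟩
  | succ n ih =>
    obtain ⟨v, w, rfl⟩ : ∃ (v : Fin n → K) (w : K), u = (Fin.snoc v w : Fin (n + 1) → K) :=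
      ⟨Fin.init u, u (Fin.last n), (Fin.snoc_init_self u).symm⟩
    have hne : ∀ j k : Fin n, j ≠ k → j.castSucc ≠ k.castSucc := fun j k h h' =>
      h (Fin.castSucc_injective n h')
    have hnl : ∀ j : Fin n, j.castSucc ≠ Fin.last n := fun j => (Fin.castSucc_lt_last j).ne
    have := goodRel_step t a b c d e f ht ha hb hc hd he hf hcon1 hcon2 v w _ _
      (by simpa using hab (Fin.last n)) (by simpa using hef (Fin.last n))
      (fun j => by simpa using hab j.castSucc) (fun j => by simpa using hef j.castSucc)
      (fun j => by simpa using hdist _ _ (hnl j))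
      (fun j => by simpa using htdist _ _ (hnl j))
      (fun j => by simpa using htdist _ _ (hnl j).symm)
      (fun j k h => by simpa using htdist _ _ (hne j k h))
      (ih v (fun j => by simpa using hab j.castSucc) (fun j => by simpa using hef j.castSucc)
        (fun j k h => by simpa using hdist _ _ (hne j k h))
        (fun j k h => by simpa using htdist _ _ (hne j k h)))
    rw [colT_zero_succ, colT_one_succ]
    exact this.map (Matrix.reindexAlgEquiv K K (lastEquiv n)).toAlgHom

theorem colC_decomposition {n : ℕ} (t a b c d e f : K)
    (ht : t ≠ 1) (ha : a ≠ 0) (hb : b ≠ 0) (hc : c ≠ 0) (hd : d ≠ 0)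
    (he : e ≠ 0) (hf : f ≠ 0)
    (hcon1 : c * d + a * f = 0) (hcon2 : t * (c * d) + b * e = 0)
    (u : Fin n → K)
    (hab : ∀ j, a * u j + b ≠ 0) (hef : ∀ j, e * u j + f ≠ 0)
    (hdist : ∀ j k, j ≠ k → u j ≠ u k)
    (htdist : ∀ j k, j ≠ k → t * u j ≠ u k) :
    ∃ Cj : Fin n → Matrix (Fin n → Fin 2) (Fin n → Fin 2) K,
      (∑ j, Cj j) = colC n t a b c d e f u ∧
      (∀ j, Cj j * colA n t a b c d e f u =
          ((e * u j + f) / (a * u j + b)) • (colA n t a b c d e f u * Cj j)) ∧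
      (∀ j, Cj j * Cj j = 0) ∧
      (∀ j k, j ≠ k → Cj j * Cj k =
          ((e * u j + f) * (a * u k + b) * (u j - t * u k) /
            ((a * u j + b) * (e * u k + f) * (t * u j - u k))) • (Cj k * Cj j)) := by
  obtain ⟨_, Cj, _, _, h⟩ := goodRel_colT n t a b c d e f ht ha hb hc hd he hf hcon1 hcon2 u
    hab hef hdist htdist
  exact ⟨Cj, h⟩
end

section
/- For N ≤ M, the wavefunction for the consecutive particle configuration (x₁,…,x_N) = (1,2,…,N) factorizes through the domain wall boundary partition function: ⟨1 2 ⋯ N| B(u_N)⋯B(u₁) |Ω⟩ = Z_N(u₁,…,u_N) · ∏_{j=1}^N (a u_j+b)^{M−N}, where the left-hand side is the wavefunction on M sites and Z_N(u₁,…,u_N) = ⟨1⋯N| B_N(u₁)⋯B_N(u_N) |Ω⟩ is the domain wall boundary partition function on N sites. -/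
open Finset

variable {K : Type*} [Field K]

/-- The operator `B(u) = ⟨0|ₐ L_{aM}(u) ⋯ L_{a1}(u) |1⟩ₐ` on `M` sites,
as a matrix in the standard basis of `(ℂ²)^{⊗M}` indexed by `Fin M → Fin 2`. -/
def Bop (M : ℕ) (t a b c d e f u : K) :
    Matrix (Fin M → Fin 2) (Fin M → Fin 2) K :=
  Matrix.of fun γ β =>
    ∑ α : Fin (M + 1) → Fin 2,
      if α 0 = 1 ∧ α (Fin.last M) = 0 then
        ∏ j : Fin M, LL t a b c d e f u (α j.succ) (γ j) (α j.castSucc) (β j)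
      else 0

/-- The basis vector index of `(ℂ²)^{⊗M}` with particles (`1`s) exactly at the sites
in the range of `x`. -/
def cfg {M N : ℕ} (x : Fin N → Fin M) : Fin M → Fin 2 :=
  fun i => if ∃ j, x j = i then 1 else 0

/-- The domain wall boundary partition function
`Z_N({u}) = ⟨1⋯N| B_N(u₁) ⋯ B_N(u_N) |Ω⟩` on `N` sites. -/
def Z (N : ℕ) (t a b c d e f : K) (u : Fin N → K) : K :=
  (List.ofFn fun j => Bop N t a b c d e f (u j)).prod (fun _ => 1) (fun _ => 0)

section Helpers

/-- Ordered product `A_{M} ⋯ A_{1}` of transfer matrices. -/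
def mono {R ι : Type*} [CommRing R] [Fintype ι] [DecidableEq ι] :
    (M : ℕ) → (Fin M → Matrix ι ι R) → Matrix ι ι R
  | 0, _ => 1
  | M + 1, A => A (Fin.last M) * mono M (fun j => A j.castSucc)

/-- The `L`-operator over a commutative ring, as a matrix in the auxiliary space. -/
def Lm {R : Type*} [CommRing R] (t a b c d e f u : R) (δ β : Fin 2) :
    Matrix (Fin 2) (Fin 2) R :=
  Matrix.of fun γ α =>
    if γ = 0 ∧ δ = 0 ∧ α = 0 ∧ β = 0 then a * u + b
    else if γ = 0 ∧ δ = 1 ∧ α = 0 ∧ β = 1 then a * t * u + b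
    else if γ = 0 ∧ δ = 1 ∧ α = 1 ∧ β = 0 then (1 - t) * c * u
    else if γ = 1 ∧ δ = 0 ∧ α = 0 ∧ β = 1 then (1 - t) * d
    else if γ = 1 ∧ δ = 0 ∧ α = 1 ∧ β = 0 then e * u + f
    else if γ = 1 ∧ δ = 1 ∧ α = 1 ∧ β = 1 then e * u + t * f
    else 0

theorem mono_path {R ι : Type*} [CommRing R] [Fintype ι] [DecidableEq ι] (M : ℕ)
    (A : Fin M → Matrix ι ι R) (p q : ι) :
    (∑ α : Fin (M + 1) → ι,
      if α 0 = q ∧ α (Fin.last M) = p then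
        ∏ j : Fin M, A j (α j.succ) (α j.castSucc) else 0) = mono M A p q := by
  induction M generalizing p with
  | zero =>
    rw [← (Equiv.funUnique (Fin 1) ι).symm.sum_comp]
    simp only [mono, Matrix.one_apply]
    by_cases h : p = q
    · subst h; simp [Equiv.funUnique]
    · rw [if_neg h]
      apply Finset.sum_eq_zero
      intro x _
      rw [if_neg]
      rintro ⟨h1, h2⟩
      exact h (h2.symm.trans h1)
  | succ M ih =>
    rw [← (Fin.snocEquiv (fun _ : Fin (M + 2) => ι)).sum_comp, Fintype.sum_prod_type]
    simp only [mono, Matrix.mul_apply, ← ih, Fin.snocEquiv_apply]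
    rw [Finset.sum_eq_single p]
    · simp_rw [Finset.mul_sum]
      rw [Finset.sum_comm]
      apply Finset.sum_congr rfl
      intro α _
      have h0 : (Fin.snoc α p : Fin (M + 2) → ι) 0 = α 0 := by
        rw [← Fin.castSucc_zero, Fin.snoc_castSucc]
      rw [Finset.sum_eq_single (α (Fin.last M))]
      · simp only [h0, Fin.snoc_last, and_true, Fin.prod_univ_castSucc, Fin.snoc_castSucc,
          Fin.succ_last, ← Fin.castSucc_succ]
        split_ifs
        · rw [mul_comm]
        · simp
      · intro b _ hb
        rw [if_neg (fun h => hb h.2.symm), mul_zero]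
      · simp
    · intro b _ hb
      apply Finset.sum_eq_zero
      intro α _
      rw [if_neg]
      simp [hb]
    · simp

theorem Bop_eq {K : Type*} [Field K] (M : ℕ) (t a b c d e f u : K) (γ β : Fin M → Fin 2) :
    Bop M t a b c d e f u γ β = mono M (fun j => Lm t a b c d e f u (γ j) (β j)) 0 1 := by
  rw [← mono_path]
  rfl

/-- Two-row transfer matrices. -/
def Wm {R : Type*} [CommRing R] (t a b c d e f u v : R) (δ β : Fin 2) :
    Matrix (Fin 2 × Fin 2) (Fin 2 × Fin 2) R :=
  ∑ η, Matrix.kroneckerMap (· * ·) (Lm t a b c d e f u δ η) (Lm t a b c d e f v η β)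

theorem mono_two {R : Type*} [CommRing R] (M : ℕ) (t a b c d e f u v : R)
    (γ β : Fin M → Fin 2) :
    ∑ η : Fin M → Fin 2,
      Matrix.kroneckerMap (· * ·) (mono M (fun j => Lm t a b c d e f u (γ j) (η j)))
       (mono M (fun j => Lm t a b c d e f v (η j) (β j))) =
      mono M (fun j => Wm t a b c d e f u v (γ j) (β j)) := by
  induction M with
  | zero => simp [mono]
  | succ M ih =>
    rw [← (Fin.snocEquiv (fun _ : Fin (M + 1) => Fin 2)).sum_comp, Fintype.sum_prod_type]
    simp only [mono, ← ih, Fin.snocEquiv_apply, Fin.snoc_last, Fin.snoc_castSucc,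
      Matrix.mul_kronecker_mul]
    rw [Wm, Finset.sum_mul_sum]

/-- The `R`-matrix (braided form). -/
def Rm {R : Type*} [CommRing R] (t u v : R) : Matrix (Fin 2 × Fin 2) (Fin 2 × Fin 2) R :=
  Matrix.of fun p q =>
    if p = (0, 0) ∧ q = (0, 0) then u - t * v
    else if p = (1, 1) ∧ q = (1, 1) then u - t * v
    else if p = (0, 1) ∧ q = (0, 1) then (1 - t) * v
    else if p = (0, 1) ∧ q = (1, 0) then u - v
    else if p = (1, 0) ∧ q = (0, 1) then t * (u - v)
    else if p = (1, 0) ∧ q = (1, 0) then (1 - t) * u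
    else 0

set_option maxHeartbeats 8000000 in
theorem RLL {R : Type*} [CommRing R] (t a b c d e f u v : R)
    (h1 : c * d + a * f = 0) (h2 : t * (c * d) + b * e = 0) (δ β : Fin 2) :
    Rm t u v * Wm t a b c d e f u v δ β = Wm t a b c d e f v u δ β * Rm t u v := by
  ext ⟨p, p'⟩ ⟨q, q'⟩
  fin_cases δ <;> fin_cases β <;> fin_cases p <;> fin_cases p' <;> fin_cases q <;>
    fin_cases q' <;>
    simp [Matrix.mul_apply, Fintype.sum_prod_type, Rm, Wm, Lm, Matrix.add_apply] <;>
    grind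

theorem mono_RLL {R : Type*} [CommRing R] (M : ℕ) (t a b c d e f u v : R)
    (h1 : c * d + a * f = 0) (h2 : t * (c * d) + b * e = 0) (γ β : Fin M → Fin 2) :
    Rm t u v * mono M (fun j => Wm t a b c d e f u v (γ j) (β j)) =
      mono M (fun j => Wm t a b c d e f v u (γ j) (β j)) * Rm t u v := by
  induction M with
  | zero => simp [mono]
  | succ M ih =>
    simp only [mono]
    rw [← mul_assoc, RLL _ _ _ _ _ _ _ _ _ h1 h2, mul_assoc, ih, mul_assoc]

theorem mono_comm_mul {R : Type*} [CommRing R] (M : ℕ) (t a b c d e f u v : R)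
    (h1 : c * d + a * f = 0) (h2 : t * (c * d) + b * e = 0) (γ β : Fin M → Fin 2) :
    (u - t * v) * mono M (fun j => Wm t a b c d e f u v (γ j) (β j)) (0, 0) (1, 1) =
    (u - t * v) * mono M (fun j => Wm t a b c d e f v u (γ j) (β j)) (0, 0) (1, 1) := by
  have h := congrFun (congrFun (mono_RLL M t a b c d e f u v h1 h2 γ β) (0, 0)) (1, 1)
  simpa [Matrix.mul_apply, Fintype.sum_prod_type, Rm, mul_comm] using h

theorem mono_map {R S ι : Type*} [CommRing R] [CommRing S] [Fintype ι] [DecidableEq ι]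
    (φ : R →+* S) (M : ℕ) (A : Fin M → Matrix ι ι R) :
    (mono M A).map φ = mono M (fun j => (A j).map φ) := by
  induction M with
  | zero => simp [mono]
  | succ M ih => simp [mono, Matrix.map_mul, ih]

theorem Lm_map {R S : Type*} [CommRing R] [CommRing S] (φ : R →+* S)
    (t a b c d e f u : R) (δ β : Fin 2) :
    (Lm t a b c d e f u δ β).map φ =
      Lm (φ t) (φ a) (φ b) (φ c) (φ d) (φ e) (φ f) (φ u) δ β := by
  ext p q
  simp only [Lm, Matrix.map_apply, Matrix.of_apply]
  split_ifs <;> simp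

theorem Wm_map {R S : Type*} [CommRing R] [CommRing S] (φ : R →+* S)
    (t a b c d e f u v : R) (δ β : Fin 2) :
    (Wm t a b c d e f u v δ β).map φ =
      Wm (φ t) (φ a) (φ b) (φ c) (φ d) (φ e) (φ f) (φ u) (φ v) δ β := by
  ext p q
  simp only [Wm, ← Lm_map φ]
  simp [Matrix.add_apply]

theorem mono_comm {K : Type*} [Field K] (M : ℕ) (t a b c d e f u v : K)
    (h1 : c * d + a * f = 0) (h2 : t * (c * d) + b * e = 0) (γ β : Fin M → Fin 2) :
    mono M (fun j => Wm t a b c d e f u v (γ j) (β j)) (0, 0) (1, 1) =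
    mono M (fun j => Wm t a b c d e f v u (γ j) (β j)) (0, 0) (1, 1) := by
  let C : K →+* Polynomial K := Polynomial.C
  have h := mono_comm_mul M (C t) (C a) (C b) (C c) (C d) (C e) (C f) (Polynomial.X + C u) (C v)
    (by rw [← map_mul, ← map_mul, ← map_add, h1, map_zero])
    (by rw [← map_mul, ← map_mul, ← map_mul, ← map_add, h2, map_zero]) γ β
  have hne : Polynomial.X + C u - C t * C v ≠ 0 := by
    have : Polynomial.X + C u - C t * C v = Polynomial.X + Polynomial.C (u - t * v) := by
      simp [C]; ring
    rw [this]
    exact Polynomial.X_add_C_ne_zero _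
  have h' := congrArg (Polynomial.evalRingHom (0 : K)) (mul_left_cancel₀ hne h)
  simp only [← Matrix.map_apply (f := Polynomial.evalRingHom (0 : K)), mono_map, Wm_map] at h'
  simpa [C] using h'

theorem Bop_mul {K : Type*} [Field K] (M : ℕ) (t a b c d e f u v : K) (γ β : Fin M → Fin 2) :
    (Bop M t a b c d e f u * Bop M t a b c d e f v) γ β =
      mono M (fun j => Wm t a b c d e f u v (γ j) (β j)) (0, 0) (1, 1) := by
  rw [← mono_two, Matrix.mul_apply, Matrix.sum_apply]
  simp [Bop_eq]

theorem Bop_comm {K : Type*} [Field K] (M : ℕ) (t a b c d e f u v : K)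
    (h1 : c * d + a * f = 0) (h2 : t * (c * d) + b * e = 0) :
    Commute (Bop M t a b c d e f u) (Bop M t a b c d e f v) := by
  ext γ β
  rw [Bop_mul, Bop_mul, mono_comm M t a b c d e f u v h1 h2]

theorem Bop_snoc {K : Type*} [Field K] (M : ℕ) (t a b c d e f u : K) (γ β : Fin M → Fin 2)
    (x : Fin 2) :
    Bop (M + 1) t a b c d e f u (Fin.snoc γ 0) (Fin.snoc β x) =
      if x = 0 then (a * u + b) * Bop M t a b c d e f u γ β else 0 := by
  simp only [Bop_eq, mono, Fin.snoc_last, Fin.snoc_castSucc, Matrix.mul_apply, Fin.sum_univ_two]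
  fin_cases x <;> simp [Lm]

theorem list_snoc {K : Type*} [Field K] (M : ℕ) (t a b c d e f : K) (l : List K)
    (γ : Fin M → Fin 2) :
    (l.map (Bop (M + 1) t a b c d e f)).prod (Fin.snoc γ 0) (fun _ => 0) =
      (l.map (Bop M t a b c d e f)).prod γ (fun _ => 0) * (l.map fun u => a * u + b).prod := by
  induction l generalizing γ with
  | nil =>
    have h : (Fin.snoc γ 0 : Fin (M + 1) → Fin 2) = (fun _ => 0) ↔ γ = fun _ => 0 := by
      constructor
      · intro h
        funext j
        simpa using congrFun h j.castSucc
      · rintro rfl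
        funext j
        refine Fin.lastCases ?_ (fun i => ?_) j <;> simp
    simp [Matrix.one_apply, h]
  | cons u l ih =>
    simp only [List.map_cons, List.prod_cons, Matrix.mul_apply]
    rw [← (Fin.snocEquiv (fun _ : Fin (M + 1) => Fin 2)).sum_comp, Fintype.sum_prod_type]
    have hs (x : Fin 2) (y : Fin M → Fin 2) :
      (Fin.snocEquiv (fun _ : Fin (M + 1) => Fin 2)) (x, y) = Fin.snoc y x := rfl
    simp only [hs, Bop_snoc, Fin.sum_univ_two, ih]
    simp only [if_true, one_ne_zero, if_false, zero_mul, Finset.sum_const_zero, add_zero,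
      Finset.sum_mul]
    exact Finset.sum_congr rfl fun _ _ => by ring

theorem list_add {K : Type*} [Field K] (N m : ℕ) (t a b c d e f : K) (l : List K) :
    (l.map (Bop (N + m) t a b c d e f)).prod
        (cfg fun j : Fin N => Fin.castLE (Nat.le_add_right N m) j) (fun _ => 0) =
      (l.map (Bop N t a b c d e f)).prod (fun _ => 1) (fun _ => 0) *
        (l.map fun u => a * u + b).prod ^ m := by
  induction m with
  | zero =>
    have : (cfg fun j : Fin N => Fin.castLE (Nat.le_add_right N 0) j) = fun _ => 1 := by
      funext i
      exact if_pos ⟨i, rfl⟩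
    rw [this]
    simp
  | succ m ih =>
    have : (cfg fun j : Fin N => Fin.castLE (Nat.le_add_right N (m + 1)) j) =
        (Fin.snoc (cfg fun j : Fin N => Fin.castLE (Nat.le_add_right N m) j) 0 :
          Fin (N + m + 1) → Fin 2) := by
      funext i
      refine Fin.lastCases (n := N + m) ?_ (fun i => ?_) i
      · rw [Fin.snoc_last]
        apply if_neg
        rintro ⟨j, hj⟩
        have := congrArg Fin.val hj
        simp at this
        omega
      · rw [Fin.snoc_castSucc]
        simp [cfg, Fin.ext_iff]
    rw [this, pow_succ, ← mul_assoc, ← ih]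
    exact list_snoc (N + m) t a b c d e f l _

end Helpers

theorem wavefunction_factorizes {M N : ℕ} (hNM : N ≤ M) (t a b c d e f : K)
    (ht : t ≠ 1) (ha : a ≠ 0) (hb : b ≠ 0) (hc : c ≠ 0) (hd : d ≠ 0)
    (he : e ≠ 0) (hf : f ≠ 0)
    (hcon1 : c * d + a * f = 0) (hcon2 : t * (c * d) + b * e = 0)
    (u : Fin N → K) :
    (List.ofFn fun j => Bop M t a b c d e f (u j)).reverse.prod
        (cfg fun j : Fin N => Fin.castLE hNM j) (fun _ => 0) =
      Z N t a b c d e f u * ∏ j, (a * u j + b) ^ (M - N) := by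
  obtain ⟨m, rfl⟩ := Nat.exists_eq_add_of_le hNM
  have hperm : (List.ofFn fun j => Bop (N + m) t a b c d e f (u j)).reverse.prod =
      (List.ofFn fun j => Bop (N + m) t a b c d e f (u j)).prod := by
    refine (List.reverse_perm _).prod_eq' ?_
    refine List.pairwise_of_forall_mem_list ?_
    intro x hx y hy
    simp only [List.mem_reverse, List.mem_ofFn] at hx hy
    obtain ⟨i, rfl⟩ := hx
    obtain ⟨j, rfl⟩ := hy
    exact Bop_comm _ _ _ _ _ _ _ _ _ _ hcon1 hcon2
  have h := list_add N m t a b c d e f (List.ofFn u)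
  simp only [List.map_ofFn, Function.comp_def] at h
  rw [hperm, h, Z, Finset.prod_pow, List.prod_ofFn, Nat.add_sub_cancel_left]
end
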